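/- For every natural number n, the second derivative of the n-th Legendre polynomial satisfies the expansion L_n''(x) = Σ_{k=0}^{n−2} (k + 1/2)(n(n+1) − k(k+1)) L_k(x), where the sum runs over those k with 0 ≤ k ≤ n−2 for which k + n is even. This is an identity of polynomials. -/

import Mathlib

open Polynomial

/-- The `n`-th Legendre polynomial on `[−1, 1]`, via the Rodrigues formula
`L_n(x) = (1/(2ⁿ n!)) (d/dx)ⁿ (x² − 1)ⁿ`. -/
noncomputable def legendre (n : ℕ) : Polynomial ℝ :=
  C (1 / (2 ^ n * n.factorial : ℝ)) * derivative^[n] ((X ^ 2 - 1) ^ n)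

theorem derivative_derivative_sq_sub_one_pow (n : ℕ) :
    derivative (derivative ((X ^ 2 - 1 : ℝ[X]) ^ (n + 2))) =
      C (2 * ((n : ℝ) + 2) * (2 * n + 3)) * (X ^ 2 - 1) ^ (n + 1) +
        C (4 * ((n : ℝ) + 2) * (n + 1)) * (X ^ 2 - 1) ^ n := by
  simp only [derivative_pow, derivative_mul, derivative_sub, derivative_X, derivative_one,
    derivative_natCast, derivative_zero, C_mul, C_add, map_natCast, map_ofNat, map_one,
    Nat.add_sub_cancel, show n + 2 - 1 = n + 1 from rfl]
  push_cast
  ring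

theorem legendre_zero : legendre 0 = 1 := by
  simp [legendre]

theorem legendre_one : legendre 1 = X := by
  have h : derivative ((X : ℝ[X]) ^ 2 - 1) = C 2 * X := by
    simp [derivative_pow]
  rw [legendre, Function.iterate_one, pow_one, pow_one, h, ← mul_assoc, ← C_mul]
  norm_num

/-- The recurrence `L_{n+2}' = (2n + 3) L_{n+1} + L_n'`. -/
theorem derivative_legendre_add_two (n : ℕ) :
    derivative (legendre (n + 2)) =
      C (2 * (n : ℝ) + 3) * legendre (n + 1) + derivative (legendre n) := by
  simp only [legendre, derivative_C_mul]
  rw [← Function.iterate_succ_apply' derivative (n + 2),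
    ← Function.iterate_succ_apply' derivative n,
    Function.iterate_succ_apply, Function.iterate_succ_apply,
    derivative_derivative_sq_sub_one_pow, iterate_map_add, iterate_derivative_C_mul,
    iterate_derivative_C_mul, mul_add, ← mul_assoc, ← mul_assoc, ← mul_assoc,
    ← C_mul, ← C_mul, ← C_mul]
  congr 2
  · refine congrArg C ?_
    rw [Nat.factorial_succ (n + 1)]
    push_cast
    field_simp
    ring
  · refine congrArg C ?_
    rw [Nat.factorial_succ (n + 1), Nat.factorial_succ n]
    push_cast
    field_simp
    ring

theorem filter_even_range_add_three (n : ℕ) :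
    (Finset.range (n + 3)).filter (fun k => Even (k + (n + 2))) =
      insert (n + 2) ((Finset.range (n + 1)).filter (fun k => Even (k + n))) := by
  ext k
  simp only [Finset.mem_filter, Finset.mem_range, Finset.mem_insert, Nat.even_iff]
  omega

theorem derivative_legendre_succ (n : ℕ) :
    derivative (legendre (n + 1)) =
      ∑ k ∈ (Finset.range (n + 1)).filter (fun k => Even (k + n)),
        C (2 * (k : ℝ) + 1) * legendre k := by
  induction n using Nat.twoStepInduction with
  | zero => simp [Finset.sum_filter, legendre_zero, legendre_one]
  | one =>
    rw [derivative_legendre_add_two]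
    norm_num [Finset.sum_filter, Finset.sum_range_succ, legendre_zero]
    refine Or.inl ?_
    rw [← C_1, ← C_add]
    norm_num
  | more n ih _ =>
    rw [derivative_legendre_add_two, ih, filter_even_range_add_three, Finset.sum_insert (by simp)]
    congr 3
    push_cast
    ring

/-- `L_n''(x) = Σ_{k ≤ n−2, k+n even} (k + 1/2)(n(n+1) − k(k+1)) L_k(x)`
as an identity of polynomials. -/
theorem stmt9 (n : ℕ) :
    derivative (derivative (legendre n)) =
      ∑ k ∈ (Finset.range (n - 1)).filter (fun k => Even (k + n)),
        C (((k : ℝ) + 1 / 2) * ((n : ℝ) * ((n : ℝ) + 1) - (k : ℝ) * ((k : ℝ) + 1))) *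
          legendre k := by
  induction n using Nat.twoStepInduction with
  | zero => simp [legendre_zero]
  | one => simp [legendre_one]
  | more n ih _ =>
    rw [derivative_legendre_add_two, derivative_add, derivative_C_mul, ih,
      derivative_legendre_succ, Finset.mul_sum]
    have hsub : ∑ k ∈ (Finset.range (n - 1)).filter (fun k => Even (k + n)),
        C (((k : ℝ) + 1 / 2) * ((n : ℝ) * ((n : ℝ) + 1) - (k : ℝ) * ((k : ℝ) + 1))) *
          legendre k =
        ∑ k ∈ (Finset.range (n + 1)).filter (fun k => Even (k + n)),
        C (((k : ℝ) + 1 / 2) * ((n : ℝ) * ((n : ℝ) + 1) - (k : ℝ) * ((k : ℝ) + 1))) *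
          legendre k := by
      apply Finset.sum_subset
      · intro k
        simp only [Finset.mem_filter, Finset.mem_range, Nat.even_iff]
        omega
      · intro k hk hk'
        simp only [Finset.mem_filter, Finset.mem_range, Nat.even_iff] at hk hk'
        obtain rfl : k = n := by omega
        simp
    rw [hsub, ← Finset.sum_add_distrib]
    refine Finset.sum_congr ?_ fun k _ => ?_
    · ext k
      simp only [Finset.mem_filter, Finset.mem_range, Nat.even_iff]
      omega
    · rw [← mul_assoc, ← C_mul, ← add_mul, ← C_add]
      congr 2
      push_cast
      ring
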